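/- Let F_q be a finite field with q elements. For every ε > 0 there exists δ > 0 such that for all sufficiently large q and all sets F, G, H ⊆ F_q with |F| ≥ q^ε and |G||H| ≥ q^{2-δ}, the set E(F,G,H) of λ ∈ F_q for which f + gh = λ has no solution (f,g,h) ∈ F×G×H satisfies |E(F,G,H)| = O(q^{1/2+ε}). -/

import Mathlib

open Finset

section Stepanov
open Polynomial

/-- A lacunary sum with small coefficients does not vanish. -/
lemma lacunary_ne_zero {K : Type*} [Field K] (α : K) (c N : ℕ) (e : ℕ → ℕ)
    (he : ∀ l l', l < l' → e l + c ≤ e l') (g : ℕ → K[X]) (hg : ∀ l, (g l).eval α ≠ 0)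
    (u : ℕ → K[X]) (hu : ∀ l, (u l).degree < c)
    (h0 : ∑ l ∈ range N, u l * ((X - C α) ^ e l * g l) = 0) : ∀ l < N, u l = 0 := by
  intro l
  induction l using Nat.strong_induction_on with
  | _ l ih =>
  intro hl
  have hsplit := Finset.add_sum_erase (range N) (fun l => u l * ((X - C α) ^ e l * g l))
    (mem_range.2 hl)
  rw [h0] at hsplit
  have hd : (X - C α) ^ (e l + c) ∣ u l * ((X - C α) ^ e l * g l) := by
    rw [eq_neg_of_add_eq_zero_left hsplit, dvd_neg]
    apply Finset.dvd_sum
    intro j hj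
    rw [mem_erase, mem_range] at hj
    rcases lt_or_gt_of_ne hj.1 with h | h
    · rw [ih j h hj.2]; simp
    · exact Dvd.dvd.mul_left (Dvd.dvd.mul_right (pow_dvd_pow _ (he l j h)) _) _
  have hX : (X - C α) ^ e l ≠ 0 := pow_ne_zero _ (X_sub_C_ne_zero α)
  have hd2 : (X - C α) ^ c ∣ u l * g l := by
    rw [pow_add, show u l * ((X - C α) ^ e l * g l) = (X - C α) ^ e l * (u l * g l) by ring] at hd
    exact (mul_dvd_mul_iff_left hX).1 hd
  have hcop : IsCoprime ((X - C α) ^ c) (g l) := by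
    apply IsCoprime.pow_left
    rw [(irreducible_X_sub_C α).coprime_iff_not_dvd, dvd_iff_isRoot]
    exact hg l
  have hd3 := hcop.dvd_of_dvd_mul_right hd2
  by_contra hne
  have := degree_le_of_dvd hd3 hne
  rw [degree_pow, degree_X_sub_C] at this
  have h2 := hu l
  simp at this
  exact absurd (lt_of_le_of_lt this h2) (lt_irrefl _)

lemma natCard_degreeLT (K : Type*) [Field K] [Fintype K] (n : ℕ) :
    Nat.card (degreeLT K n) = Fintype.card K ^ n := by
  rw [Nat.card_congr (degreeLTEquiv K n).toEquiv]
  simp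

instance finite_degreeLT (K : Type*) [Field K] [Fintype K] (n : ℕ) : Finite (degreeLT K n) :=
  Finite.of_equiv _ (degreeLTEquiv K n).toEquiv.symm

lemma stepanov {K : Type*} [Field K] [Fintype K] [DecidableEq K] (p s : ℕ) [Fact p.Prime]
    [CharP K p]
    (P d c m : ℕ) (hPp : P = p ^ s) (hK : Fintype.card K = P ^ 2) (hP : P = c * d + 1)
    (hP3 : 3 ≤ P) (α : K) (g : K[X]) (hg : g.eval α ≠ 0) (a : K) (ha : a ≠ 0)
    (hm : ((X - C α) * g).natDegree ≤ m) :
    #{x : K | ((X - C α) * g).eval x ^ (c * (P + 1)) = a} ≤ c * P + (4 * m + 5) * P := by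
  set f := (X - C α) * g with hf
  set T : K[X] := X - C α with hT
  set I := c + 3 * m + 5 with hI
  have hd : 1 ≤ d := by
    rcases Nat.eq_zero_or_pos d with h | h
    · subst h; omega
    · exact h
  have hc : 1 ≤ c := by
    rcases Nat.eq_zero_or_pos c with h | h
    · subst h; omega
    · exact h
  have hcd : c * d = P - 1 := by omega
  have hcP : c ≤ P - 1 := by rw [← hcd]; exact Nat.le_mul_of_pos_right _ hd
  have hcd1 : c * (d - 1) ≤ P := by
    calc c * (d - 1) ≤ c * d := Nat.mul_le_mul_left _ (by omega)
      _ ≤ P := by omega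
  have hmod : ∀ l, l % d < d := fun l => Nat.mod_lt _ hd
  -- additivity of Frobenius
  have frob : ∀ x y : K[X], (x + y) ^ P = x ^ P + y ^ P := by
    intro x y; rw [hPp]; exact add_pow_char_pow ..
  have frobsum : ∀ (S : Finset ℕ) (w : ℕ → K[X]), (∑ l ∈ S, w l) ^ P = ∑ l ∈ S, (w l) ^ P := by
    intro S w; rw [hPp]; exact sum_pow_char_pow ..
  set N := I * d with hN
  set D := P * c + I + m * P with hD
  let co : ℕ → K[X] := fun l => T ^ (l / d) * (C (a ^ (l % d)) * f ^ (c * (d - 1 - l % d)))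
  have hfdeg : f.degree ≤ (m : ℕ) := degree_le_of_natDegree_le hm
  -- the pigeonhole map
  let Wf : (Fin N → degreeLT K c) → K[X] := fun u => ∑ l : Fin N, ((u l : K[X])) ^ P * co l
  have hWdeg : ∀ u, Wf u ∈ degreeLT K D := by
    intro u
    refine Submodule.sum_mem _ fun l _ => ?_
    rw [mem_degreeLT]
    have hu := mem_degreeLT.1 (u l).2
    by_cases h0 : (u l : K[X]) = 0
    · rw [h0, zero_pow (by omega), zero_mul, degree_zero]; exact WithBot.bot_lt_coe _
    refine lt_of_le_of_lt degree_le_natDegree ?_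
    rw [Nat.cast_lt]
    have h1 : (u l : K[X]).natDegree < c := (natDegree_lt_iff_degree_lt h0).2 hu
    have h2 : (l : ℕ) / d < I := by
      rw [Nat.div_lt_iff_lt_mul hd]; exact l.2
    have h3 : (co l).natDegree ≤ (l / d) + m * P := by
      refine (natDegree_mul_le).trans (add_le_add ?_ ?_)
      · refine natDegree_pow_le.trans ?_
        rw [hT, natDegree_X_sub_C, mul_one]
      · refine (natDegree_C_mul_le _ _).trans (natDegree_pow_le.trans ?_)
        rw [mul_comm]
        refine Nat.mul_le_mul hm (le_trans (Nat.mul_le_mul_left _ ?_) hcd1)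
        omega
    have h4 := (natDegree_mul_le (p := (u l : K[X]) ^ P) (q := co l))
    have h5 := natDegree_pow_le (p := (u l : K[X])) (n := P)
    have h6 : P * (u l : K[X]).natDegree ≤ P * c := Nat.mul_le_mul_left _ h1.le
    omega
  let W : (Fin N → degreeLT K c) → degreeLT K D := fun u => ⟨Wf u, hWdeg u⟩
  have hcard : Nat.card (degreeLT K D) < Nat.card (Fin N → degreeLT K c) := by
    rw [Nat.card_fun, natCard_degreeLT, natCard_degreeLT, ← pow_mul, Nat.card_fin]
    apply Nat.pow_lt_pow_right
    · rw [hK]; nlinarith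
    · have : c * N = I * (P - 1) := by rw [hN, ← hcd]; ring
      rw [this, hD, hI]
      obtain ⟨t, rfl⟩ : ∃ t, P = t + 3 := ⟨P - 3, by omega⟩
      have : t + 3 - 1 = t + 2 := by omega
      rw [this]
      have : c ≤ t + 2 := by omega
      nlinarith
  have hninj : ¬ Function.Injective W := fun h => by
    have := Nat.card_le_card_of_injective W h
    omega
  obtain ⟨u1, u2, hWu, hne⟩ : ∃ u1 u2, W u1 = W u2 ∧ u1 ≠ u2 := by
    simpa [Function.Injective] using hninj
  let u : ℕ → K[X] := fun l => if h : l < N then (u1 ⟨l, h⟩ : K[X]) - u2 ⟨l, h⟩ else 0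
  have hudeg : ∀ l, (u l).degree < c := by
    intro l
    by_cases h : l < N
    · simp only [u, dif_pos h]
      exact mem_degreeLT.1 (Submodule.sub_mem _ (u1 ⟨l, h⟩).2 (u2 ⟨l, h⟩).2)
    · simp only [u, dif_neg h, degree_zero]; exact WithBot.bot_lt_coe _
  have hWu0 : ∑ l ∈ range N, u l ^ P * co l = 0 := by
    rw [Finset.sum_range]
    have h1 : Wf u1 = Wf u2 := congrArg Subtype.val hWu
    have h2 : Wf u1 - Wf u2 = 0 := sub_eq_zero.2 h1
    rw [← h2, ← Finset.sum_sub_distrib]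
    apply Finset.sum_congr rfl
    intro l _
    have h3 : (u1 l : K[X]) ^ P = (u l) ^ P + (u2 l : K[X]) ^ P := by
      rw [← frob]; simp [u]
    rw [h3]; ring
  let V : K[X] := ∑ l ∈ range N, u l * (T ^ (l / d * P) * f ^ (c * (l % d)))
  have hV0 : V ≠ 0 := by
    intro hV
    apply hne
    have key := lacunary_ne_zero α c N (fun l => l / d * P + c * (l % d)) ?_
      (fun l => g ^ (c * (l % d))) ?_ u hudeg ?_
    · funext l
      have := key l l.2
      simp only [u, dif_pos l.2] at this
      exact Subtype.ext (sub_eq_zero.1 this)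
    · have hform : ∀ l, l / d * P + c * (l % d) = c * l + l / d := by
        intro l
        have := Nat.div_add_mod l d
        have h2 : c * l = c * (d * (l / d) + l % d) := by rw [this]
        rw [h2, hP]; ring
      intro l l' hll
      simp only [hform]
      have h1 : l / d ≤ l' / d := Nat.div_le_div_right hll.le
      have h2 : c * (l + 1) ≤ c * l' := Nat.mul_le_mul_left _ hll
      rw [mul_add, mul_one] at h2
      omega
    · intro l
      rw [eval_pow]; exact pow_ne_zero _ hg
    · rw [← hV]
      apply Finset.sum_congr rfl
      intro l _
      rw [hf, mul_pow, pow_add]; ring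
  have hroot : ∀ x, f.eval x ^ (c * (P + 1)) = a → V.eval x = 0 := by
    intro x hx
    have hfx : f.eval x ≠ 0 := by
      intro h; rw [h, zero_pow (by positivity)] at hx; exact ha hx.symm
    set y := f.eval x with hy
    have hfr : ∀ z : K, z ^ (P * P) = z := by
      intro z; rw [← sq, ← hK]; exact FiniteField.pow_card z
    have h1 : (V ^ P).eval x * y ^ (c * (d - 1)) = (∑ l ∈ range N, u l ^ P * co l).eval x := by
      rw [show V ^ P = _ from frobsum _ _]
      rw [eval_finsetSum, eval_finsetSum, Finset.sum_mul]
      apply Finset.sum_congr rfl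
      intro l _
      simp only [co, eval_mul, eval_pow, eval_C, mul_pow, ← pow_mul, ← hy]
      have e1 : l / d * P * P = P * P * (l / d) := by ring
      rw [e1, pow_mul _ (P * P), hfr]
      rw [← hx, ← pow_mul]
      have e2 : y ^ (c * (l % d) * P) * y ^ (c * (d - 1)) =
          y ^ (c * (P + 1) * (l % d)) * y ^ (c * (d - 1 - l % d)) := by
        rw [← pow_add, ← pow_add]
        congr 1
        have := hmod l
        obtain ⟨r, hr⟩ : ∃ r, d - 1 = l % d + r := ⟨d - 1 - l % d, by omega⟩
        rw [hr, Nat.add_sub_cancel_left]; ring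
      rw [mul_assoc, mul_assoc, e2]
    rw [hWu0, eval_zero, eval_pow] at h1
    rcases mul_eq_zero.1 h1 with h | h
    · exact pow_eq_zero_iff (by omega) |>.1 h
    · exact absurd h (pow_ne_zero _ hfx)
  have hVdeg : V.natDegree ≤ c * P + (4 * m + 5) * P := by
    apply natDegree_sum_le_of_forall_le
    intro l hl
    rw [mem_range] at hl
    have h2 : (l : ℕ) / d < I := by
      rw [Nat.div_lt_iff_lt_mul hd]; exact hl
    have h1 : (u l).natDegree ≤ c := natDegree_le_of_degree_le (hudeg l).le
    refine (natDegree_mul_le).trans ?_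
    have h3 : (T ^ (l / d * P)).natDegree ≤ (I - 1) * P := by
      refine natDegree_pow_le.trans ?_
      rw [hT, natDegree_X_sub_C, mul_one]
      exact Nat.mul_le_mul_right _ (by omega)
    have h4 : (f ^ (c * (l % d))).natDegree ≤ P * m := by
      refine natDegree_pow_le.trans ?_
      refine Nat.mul_le_mul (le_trans (Nat.mul_le_mul_left _ ?_) hcd1) hm
      have := hmod l
      omega
    have h5 := natDegree_mul_le (p := T ^ (l / d * P)) (q := f ^ (c * (l % d)))
    have h6 : (I - 1) * P = c * P + 3 * (m * P) + 4 * P := by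
      rw [hI, show c + 3 * m + 5 - 1 = c + 3 * m + 4 by omega]; ring
    have h7 : (4 * m + 5) * P = 4 * (m * P) + 5 * P := by ring
    have h8 : P * m = m * P := mul_comm _ _
    omega
  refine le_trans ?_ hVdeg
  refine le_trans (Finset.card_le_card ?_) (V.roots.toFinset_card_le.trans (card_roots' V))
  intro x hx
  rw [mem_filter] at hx
  rw [Multiset.mem_toFinset, mem_roots hV0]
  exact hroot x hx.2

end Stepanov

section Sum
open Polynomial

lemma mulChar_norm_eq {F : Type*} [Field F] [Fintype F] (χ : MulChar F ℂ) (a : F) (ha : a ≠ 0) :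
    ‖χ a‖ = 1 := by
  have h := FiniteField.pow_card_sub_one_eq_one a ha
  have h2 : χ a ^ (Fintype.card F - 1) = 1 := by rw [← map_pow, h, map_one]
  exact Complex.norm_eq_one_of_pow_eq_one h2 (by have := Fintype.one_lt_card (α := F); omega)

lemma mulChar_norm_le {F : Type*} [Field F] [Fintype F] (χ : MulChar F ℂ) (a : F) :
    ‖χ a‖ ≤ 1 := by
  by_cases ha : a = 0
  · subst ha; rw [MulChar.map_zero]; simp
  · exact (mulChar_norm_eq χ a ha).le

lemma norm_sum_bound {F K : Type*} [Field F] [Fintype F] [DecidableEq F] [Field K] [Fintype K]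
    [Algebra F K] (χ : MulChar F ℂ) (hχ : χ ≠ 1) (n m : ℕ) (hn : 1 ≤ n)
    (hK : Fintype.card K = Fintype.card F ^ (2 * n)) (α : K) (g : K[X]) (hg : g.eval α ≠ 0)
    (hm : ((X - C α) * g).natDegree ≤ m) :
    ‖∑ x : K, χ (Algebra.norm F (((X - C α) * g).eval x))‖ ≤
      ((Fintype.card F * (4 * m + 5) + m : ℕ) : ℝ) * (Fintype.card F : ℝ) ^ n := by
  classical
  set f := (X - C α) * g with hf
  set q := Fintype.card F with hq
  have hq2 : 2 ≤ q := Fintype.one_lt_card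
  have hq3 : 3 ≤ q := by
    by_contra hlt
    have h2 : q = 2 := by omega
    apply hχ
    rw [MulChar.eq_one_iff]
    intro a
    have hu : Fintype.card Fˣ = 1 := by rw [Fintype.card_units, ← hq, h2]
    have : a = 1 := by
      have := Fintype.card_le_one_iff.1 hu.le a 1
      exact this
    rw [this]; simp
  obtain ⟨p, hp⟩ := CharP.exists F
  obtain ⟨s, hpp, hs⟩ := FiniteField.card F p
  have : Fact p.Prime := ⟨hpp⟩
  have : CharP K p := charP_of_injective_algebraMap (algebraMap F K).injective p
  set P := q ^ n with hP
  obtain ⟨c, hc⟩ : ∃ c, P = c * (q - 1) + 1 := by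
    have := Nat.sub_one_dvd_pow_sub_one q n
    obtain ⟨c, hc⟩ := this
    have h1 : 1 ≤ q ^ n := Nat.one_le_pow _ _ (by omega)
    exact ⟨c, by rw [mul_comm c, ← hc]; omega⟩
  have hPq : q ≤ P := by
    calc q = q ^ 1 := (pow_one q).symm
      _ ≤ q ^ n := Nat.pow_le_pow_right (by omega) hn
  have hKP : Fintype.card K = P ^ 2 := by rw [hK, hP, ← pow_mul, mul_comm]
  have hexp : (Nat.card K - 1) / (Nat.card F - 1) = c * (P + 1) := by
    rw [Nat.card_eq_fintype_card, Nat.card_eq_fintype_card, hKP, ← hq]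
    apply Nat.div_eq_of_eq_mul_left (by omega)
    have : P ^ 2 = c * (P + 1) * (q - 1) + 1 := by
      have h2 : P ^ 2 + P = P * (P + 1) := by ring
      rw [show P * (P + 1) = (c * (q - 1) + 1) * (P + 1) by rw [← hc]] at h2
      have h3 : (c * (q - 1) + 1) * (P + 1) = c * (P + 1) * (q - 1) + 1 + P := by ring
      omega
    omega
  set B := c * P + (4 * m + 5) * P with hB
  let T : F → ℕ := fun a => #{x : K | Algebra.norm F (f.eval x) = a}
  have hT : ∀ a, a ≠ 0 → T a ≤ B := by
    intro a ha
    have := stepanov p (s * n) P (q - 1) c m (by rw [hP, hq, hs, pow_mul]) hKP hc (by omega) α g hg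
      (algebraMap F K a) (by simpa using ha) hm
    refine le_trans (Finset.card_le_card ?_) this
    intro x
    simp only [mem_filter, mem_univ, true_and]
    rw [← hexp, ← FiniteField.algebraMap_norm_eq_pow, (algebraMap F K).injective.eq_iff]
    exact id
  have hfne : f ≠ 0 := mul_ne_zero (X_sub_C_ne_zero α) (by rintro rfl; simp at hg)
  have hT0 : T 0 ≤ m := by
    refine le_trans (Finset.card_le_card ?_) ((f.roots.toFinset_card_le.trans (card_roots' f)).trans hm)
    intro x hx
    simp only [mem_filter, mem_univ, true_and, Algebra.norm_eq_zero_iff] at hx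
    rw [Multiset.mem_toFinset, mem_roots hfne]
    exact hx
  have hTsum : ∑ a : F, T a = P ^ 2 := by
    rw [← hKP, ← card_univ]
    exact (Finset.card_eq_sum_card_fiberwise (f := fun x : K => Algebra.norm F (f.eval x))
      (t := univ) (fun x _ => mem_univ _)).symm
  have hS : ∑ x : K, χ (Algebra.norm F (f.eval x)) = ∑ a : F, χ a * (T a : ℂ) := by
    rw [← Finset.sum_fiberwise (s := univ) (g := fun x : K => Algebra.norm F (f.eval x))]
    apply Finset.sum_congr rfl
    intro a _
    rw [Finset.sum_congr rfl (g := fun _ => χ a)]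
    · rw [Finset.sum_const, nsmul_eq_mul, mul_comm]
    · intro x hx; rw [(mem_filter.1 hx).2]
  have hS2 : ∑ a : F, χ a * (T a : ℂ) = - ∑ a : F, χ a * ((B : ℂ) - T a) := by
    simp only [mul_sub, Finset.sum_sub_distrib]
    rw [← Finset.sum_mul, MulChar.sum_eq_zero_of_ne_one hχ]; ring
  rw [hS, hS2, norm_neg]
  have hle : ‖∑ a : F, χ a * ((B : ℂ) - T a)‖ ≤ ∑ a ∈ univ.erase (0 : F), ((B : ℝ) - T a) := by
    rw [← Finset.add_sum_erase univ _ (mem_univ (0 : F))]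
    rw [MulChar.map_zero, zero_mul, zero_add]
    refine (norm_sum_le _ _).trans (Finset.sum_le_sum ?_)
    intro a ha
    have ha0 : a ≠ 0 := (mem_erase.1 ha).1
    have h1 : ‖χ a‖ ≤ 1 := mulChar_norm_le χ a
    have h2 : (0 : ℝ) ≤ (B : ℝ) - T a := by
      have : (T a : ℝ) ≤ B := by exact_mod_cast hT a ha0
      linarith
    rw [norm_mul]
    have h3 : ‖(B : ℂ) - T a‖ = (B : ℝ) - T a := by
      rw [show (B : ℂ) - T a = (((B : ℝ) - T a : ℝ) : ℂ) by push_cast; rfl, Complex.norm_real,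
        Real.norm_of_nonneg h2]
    rw [h3]
    exact mul_le_of_le_one_left h2 h1
  refine hle.trans ?_
  have hsum : ∑ a ∈ univ.erase (0 : F), (T a : ℝ) = (P : ℝ) ^ 2 - T 0 := by
    have h1 := Finset.add_sum_erase univ T (mem_univ (0 : F))
    rw [hTsum] at h1
    have : (T 0 : ℝ) + ∑ a ∈ univ.erase (0 : F), (T a : ℝ) = (P : ℝ) ^ 2 := by exact_mod_cast h1
    linarith
  rw [Finset.sum_sub_distrib, hsum, Finset.sum_const, card_erase_of_mem (mem_univ _), card_univ,
    ← hq, nsmul_eq_mul]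
  have hq1 : ((q - 1 : ℕ) : ℝ) = (q : ℝ) - 1 := by
    rw [Nat.cast_sub (by omega)]; simp
  have hcR : (P : ℝ) = c * ((q : ℝ) - 1) + 1 := by
    rw [← hq1]; exact_mod_cast hc
  have hPR : (q : ℝ) ^ n = P := by rw [hP]; push_cast; rfl
  have hT0R : (T 0 : ℝ) ≤ m := by exact_mod_cast hT0
  have hP1 : (1 : ℝ) ≤ P := by exact_mod_cast (by omega : 1 ≤ P)
  have hm0 : (0 : ℝ) ≤ m := Nat.cast_nonneg m
  rw [hPR, hq1, hB]
  push_cast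
  have e1 : ((q : ℝ) - 1) * (c * P + (4 * m + 5) * P) =
     (P - 1) * P + (q - 1) * ((4 * m + 5) * P) := by
    rw [show (P : ℝ) - 1 = c * ((q : ℝ) - 1) by linarith]; ring
  rw [e1]
  nlinarith [mul_nonneg hm0 (sub_nonneg.2 hP1), mul_nonneg hm0 (by linarith : (0 : ℝ) ≤ P)]

end Sum

section PowerSums

lemma recurrence_bound {ι : Type*} [Fintype ι] (ω : ι → ℂ) (C r : ℝ) (hr : 0 < r)
    (h : ∀ n : ℕ, 1 ≤ n → ‖∑ i, ω i ^ (2 * n)‖ ≤ C * r ^ (2 * n)) (i : ι) : ‖ω i‖ ≤ r := by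
  by_contra hlt
  push Not at hlt
  let u : ι → ℂ := fun i => if ω i = 0 then 1 else (ω i) ^ 2 / (‖ω i‖ : ℂ) ^ 2
  have hu1 : ∀ i, ‖u i‖ = 1 := by
    intro i
    by_cases h0 : ω i = 0
    · simp [u, h0]
    · have : ‖ω i‖ ≠ 0 := norm_ne_zero_iff.2 h0
      simp [u, h0]
  have hu2 : ∀ i, ω i ^ 2 = (‖ω i‖ : ℂ) ^ 2 * u i := by
    intro i
    by_cases h0 : ω i = 0
    · simp [u, h0]
    · have : (‖ω i‖ : ℂ) ≠ 0 := by simpa using h0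
      simp only [u, if_neg h0]
      field_simp
  have hcomp : IsCompact (Set.pi Set.univ fun _ : ι => Metric.closedBall (0 : ℂ) 1) :=
    isCompact_univ_pi fun _ => isCompact_closedBall _ _
  obtain ⟨v, -, φ, hφ, hlim⟩ := hcomp.tendsto_subseq (x := fun n : ℕ => fun i => u i ^ n) (by
    intro n
    rw [Set.mem_univ_pi]
    intro i
    simp [hu1])
  have hcau := hlim.cauchySeq
  rw [Metric.cauchySeq_iff'] at hcau
  obtain ⟨J, hJ⟩ := hcau (1 / 2) (by norm_num)
  have key : ∀ N : ℕ, 1 ≤ N → ∃ n, N ≤ n ∧ (‖ω i‖ / r) ^ (2 * n) ≤ 2 * C := by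
    intro N hN
    have hge : φ J + N ≤ φ (J + N) := by
      have := hφ.add_le_nat N J
      rw [add_comm N (φ J), add_comm N J] at this
      exact this
    refine ⟨φ (J + N) - φ J, by omega, ?_⟩
    set n := φ (J + N) - φ J with hn
    have hd := hJ (J + N) (by omega)
    rw [dist_pi_lt_iff (by norm_num)] at hd
    have hre : ∀ i, (1 / 2 : ℝ) ≤ (u i ^ n).re := by
      intro i
      have h1 := hd i
      simp only [Function.comp] at h1
      have h2 : u i ^ φ (J + N) - u i ^ φ J = u i ^ φ J * (u i ^ n - 1) := by
        rw [mul_sub, ← pow_add, hn, mul_one]; congr 2; omega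
      rw [dist_eq_norm, h2, norm_mul, norm_pow, hu1, one_pow, one_mul] at h1
      have h3 := (Complex.abs_re_le_norm (u i ^ n - 1)).trans h1.le
      rw [abs_le] at h3
      simp at h3
      linarith
    have hb := h n (by omega)
    have hs : (‖ω i‖ ^ (2 * n)) / 2 ≤ (∑ i, ω i ^ (2 * n)).re := by
      have hterm : ∀ i, (ω i ^ (2 * n)).re = ‖ω i‖ ^ (2 * n) * (u i ^ n).re := by
        intro i
        rw [pow_mul, hu2, mul_pow, ← pow_mul, ← Complex.ofReal_pow, Complex.re_ofReal_mul]
      rw [Complex.re_sum]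
      calc (‖ω i‖ ^ (2 * n)) / 2 ≤ (ω i ^ (2 * n)).re := by
            rw [hterm, div_eq_mul_one_div]
            exact mul_le_mul_of_nonneg_left (hre i) (by positivity)
        _ ≤ _ := by
            apply Finset.single_le_sum (f := fun i => (ω i ^ (2 * n)).re) _ (mem_univ i)
            intro j _
            simp only [hterm]
            have := hre j
            positivity
    have := hs.trans ((Complex.re_le_norm _).trans hb)
    rw [div_pow, div_le_iff₀ (by positivity)]
    linarith
  have h1 : 1 < ‖ω i‖ / r := by rwa [one_lt_div hr]
  obtain ⟨N, hN⟩ := pow_unbounded_of_one_lt (2 * C) h1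
  obtain ⟨n, hn, hle⟩ := key (N + 1) (by omega)
  have : (‖ω i‖ / r) ^ N ≤ (‖ω i‖ / r) ^ (2 * n) := pow_le_pow_right₀ h1.le (by omega)
  linarith

open Polynomial in
lemma exists_inv_roots (L : ℂ[X]) (h0 : L.coeff 0 = 1) :
    ∃ Ω : Multiset ℂ, Ω.card ≤ L.natDegree ∧ L = (Ω.map fun w => 1 - C w * X).prod := by
  have hL : L ≠ 0 := by rintro rfl; simp at h0
  have hs := (IsAlgClosed.splits L).eq_prod_roots
  have hne : ∀ x ∈ L.roots, x ≠ 0 := by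
    rintro x hx rfl
    rw [mem_roots hL, IsRoot, ← coeff_zero_eq_eval_zero, h0] at hx
    exact one_ne_zero hx
  refine ⟨L.roots.map fun x => x⁻¹, by simpa using card_roots' L, ?_⟩
  have h1 : L = C (L.leadingCoeff * (L.roots.map fun x => -x).prod) *
      ((L.roots.map fun x => x⁻¹).map fun w => 1 - C w * X).prod := by
    conv_lhs => rw [hs]
    rw [C_mul, mul_assoc, ← Multiset.prod_hom _ (C : ℂ →+* ℂ[X]), Multiset.map_map, Multiset.map_map,
      ← Multiset.prod_map_mul]
    congr 2
    apply Multiset.map_congr rfl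
    intro x hx
    have := hne x hx
    simp only [Function.comp]
    rw [mul_sub, mul_one, ← mul_assoc, ← C_mul, neg_mul, mul_inv_cancel₀ this]
    simp; ring
  have h2 : L.leadingCoeff * (L.roots.map fun x => -x).prod = 1 := by
    have h3 := h0
    rw [h1, coeff_zero_eq_eval_zero, eval_mul, eval_C, eval_multiset_prod] at h3
    simpa using h3
  rw [h2, C_1, one_mul] at h1
  exact h1

open PowerSeries in
lemma newton_series (Ω : Multiset ℂ) :
    X * PowerSeries.derivative ℂ ((Ω.map fun w => 1 - C w * X).prod) =
      - ((Ω.map fun w => 1 - C w * X).prod *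
        PowerSeries.mk fun n => if n = 0 then 0 else (Ω.map fun w => w ^ n).sum) := by
  induction Ω using Multiset.induction with
  | empty => ext n; simp
  | cons w Ω ih =>
    have h1 : (PowerSeries.mk fun n => if n = 0 then 0 else ((w ::ₘ Ω).map fun w => w ^ n).sum) =
        (PowerSeries.mk fun n => if n = 0 then 0 else w ^ n) +
        (PowerSeries.mk fun n => if n = 0 then 0 else (Ω.map fun w => w ^ n).sum) := by
      ext n
      by_cases h : n = 0 <;> simp [h]
    have h2 : (1 - C w * X) * (PowerSeries.mk fun n => if n = 0 then 0 else w ^ n) = C w * X := by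
      ext n
      rw [sub_mul, one_mul, map_sub, mul_assoc, coeff_C_mul, coeff_C_mul]
      rcases n with _ | n
      · simp
      · rw [coeff_succ_X_mul, coeff_mk, coeff_mk, coeff_X]
        rcases n with _ | n
        · simp
        · simp; ring
    rw [h1, Multiset.map_cons, Multiset.prod_cons, Derivation.leibniz, smul_eq_mul, smul_eq_mul]
    set M := (Ω.map fun w => 1 - C w * X).prod with hM
    have h3 : PowerSeries.derivative ℂ (1 - C w * X : PowerSeries ℂ) = - C w := by
      rw [map_sub, Derivation.leibniz]
      simp
    rw [h3, mul_add]
    rw [show X * ((1 - C w * X) * PowerSeries.derivative ℂ M) =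
      (1 - C w * X) * (X * PowerSeries.derivative ℂ M) by ring, ih]
    linear_combination M * h2

lemma coeff_bound (c S : ℕ → ℂ) (D : ℕ) (C r : ℝ) (hr : 0 < r) (hc0 : c 0 = 1)
    (hcD : ∀ k, D < k → c k = 0) (hS0 : S 0 = 0)
    (hrec : ∀ n : ℕ, (n : ℂ) * c n = ∑ x ∈ HasAntidiagonal.antidiagonal n, S x.1 * c x.2)
    (hS : ∀ n, 1 ≤ n → ‖S (2 * n)‖ ≤ C * r ^ (2 * n)) : ‖c 1‖ ≤ D * r := by
  let L : Polynomial ℂ := ∑ k ∈ range (D + 1), Polynomial.monomial k (c k)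
  have hLc : ∀ k, L.coeff k = c k := by
    intro k
    simp only [L, Polynomial.finsetSum_coeff, Polynomial.coeff_monomial, Finset.sum_ite_eq',
      mem_range]
    split_ifs with h
    · rfl
    · rw [hcD k (by omega)]
  have hLd : L.natDegree ≤ D := by
    rw [Polynomial.natDegree_le_iff_coeff_eq_zero]
    intro k hk; rw [hLc, hcD k hk]
  obtain ⟨Ω, hcard, hprod⟩ := exists_inv_roots L (by rw [hLc, hc0])
  have hL2 : (L : PowerSeries ℂ) = (Ω.map fun w => 1 - PowerSeries.C w * PowerSeries.X).prod := by
    rw [hprod, ← Polynomial.coeToPowerSeries.ringHom_apply, map_multiset_prod, Multiset.map_map]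
    congr 1
    apply Multiset.map_congr rfl
    intro w _
    simp
  have hnew := newton_series Ω
  rw [← hL2] at hnew
  have hrec2 : PowerSeries.X * PowerSeries.derivative ℂ (L : PowerSeries ℂ) =
      (L : PowerSeries ℂ) * PowerSeries.mk S := by
    ext n
    rw [mul_comm (L : PowerSeries ℂ), PowerSeries.coeff_mul n (PowerSeries.mk S)]
    simp only [PowerSeries.coeff_mk, Polynomial.coeff_coe, hLc]
    rw [← hrec]
    rcases n with _ | n
    · simp
    · rw [PowerSeries.coeff_succ_X_mul, PowerSeries.coeff_derivative, Polynomial.coeff_coe, hLc]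
      push_cast; ring
  have hLne : (L : PowerSeries ℂ) ≠ 0 := by
    intro h
    have := congrArg (PowerSeries.coeff 0) h
    rw [Polynomial.coeff_coe, hLc, hc0] at this
    simp at this
  have hSeq : PowerSeries.mk S =
      - PowerSeries.mk fun n => if n = 0 then 0 else (Ω.map fun w => w ^ n).sum := by
    apply mul_left_cancel₀ hLne
    rw [← hrec2, hnew, mul_neg]
  have hSn : ∀ n, 1 ≤ n → S n = - ∑ i : Ω, (i.1 : ℂ) ^ n := by
    intro n hn
    have := congrArg (PowerSeries.coeff n) hSeq
    rw [map_neg, PowerSeries.coeff_mk, PowerSeries.coeff_mk, if_neg (by omega)] at this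
    rw [this]
    congr 1
    conv_lhs => rw [← Multiset.map_univ_coe Ω]
    rw [Multiset.map_map]; rfl
  have hbound : ∀ i : Ω, ‖(i.1 : ℂ)‖ ≤ r := by
    apply recurrence_bound (fun i : Ω => (i.1 : ℂ)) C r hr
    intro n hn
    have := hS n hn
    rwa [hSn _ (by omega), norm_neg] at this
  have hc1 : c 1 = S 1 := by
    have := hrec 1
    simpa [Finset.Nat.antidiagonal_succ, hc0, hS0] using this
  rw [hc1, hSn 1 le_rfl, norm_neg]
  refine (norm_sum_le _ _).trans ?_
  simp only [pow_one]
  refine (Finset.sum_le_card_nsmul _ _ r fun i _ => hbound i).trans ?_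
  rw [nsmul_eq_mul, card_univ, Multiset.card_coe]
  have : (Ω.card : ℝ) ≤ D := by exact_mod_cast hcard.trans hLd
  exact mul_le_mul_of_nonneg_right this hr.le

end PowerSums

section Euler
open Polynomial UniqueFactorizationMonoid

lemma finite_natDegree_le (F : Type*) [Field F] [Fintype F] (n : ℕ) :
    {g : F[X] | g.natDegree ≤ n}.Finite := by
  have : Finite (degreeLT F (n + 1)) :=
    Finite.of_equiv _ (degreeLTEquiv F (n + 1)).toEquiv.symm
  refine (Set.toFinite (degreeLT F (n + 1) : Set F[X])).subset ?_
  intro g hg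
  rw [SetLike.mem_coe, mem_degreeLT]
  refine lt_of_le_of_lt degree_le_natDegree ?_
  have : g.natDegree ≤ n := hg
  exact_mod_cast Nat.lt_succ_of_le this

/-- Monic polynomials of degree `n`. -/
noncomputable def monPoly (F : Type*) [Field F] [Fintype F] (n : ℕ) : Finset F[X] :=
  ((finite_natDegree_le F n).subset
    (fun g (hg : g.Monic ∧ g.natDegree = n) => hg.2.le) :
      {g : F[X] | g.Monic ∧ g.natDegree = n}.Finite).toFinset

/-- Monic irreducible polynomials of degree dividing `n` (for positive `n`). -/
noncomputable def irrPoly (F : Type*) [Field F] [Fintype F] (n : ℕ) : Finset F[X] :=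
  ((finite_natDegree_le F n).subset
    (fun g (hg : g.Monic ∧ Irreducible g ∧ g.natDegree ∣ n ∧ g.natDegree ≤ n) => hg.2.2.2) :
      {g : F[X] | g.Monic ∧ Irreducible g ∧ g.natDegree ∣ n ∧ g.natDegree ≤ n}.Finite).toFinset

variable {F : Type*} [Field F] [Fintype F]

lemma mem_monPoly {n : ℕ} {g : F[X]} : g ∈ monPoly F n ↔ g.Monic ∧ g.natDegree = n := by
  simp [monPoly]

lemma mem_irrPoly {n : ℕ} {g : F[X]} : g ∈ irrPoly F n ↔
    g.Monic ∧ Irreducible g ∧ g.natDegree ∣ n ∧ g.natDegree ≤ n := by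
  simp [irrPoly]

open Classical in
lemma degree_identity (g : F[X]) (hg : g.Monic) :
    ∑ i ∈ range (g.natDegree + 1), ∑ P ∈ irrPoly F i,
      (if P ^ (i / P.natDegree) ∣ g then P.natDegree else 0) = g.natDegree := by
  set n := g.natDegree with hn
  have hg0 : g ≠ 0 := hg.ne_zero
  set nf := normalizedFactors g with hnf
  have hirr : ∀ P ∈ nf, Irreducible P := fun P hP => irreducible_of_normalized_factor P hP
  have hmon : ∀ P ∈ nf, P.Monic := fun P hP => by
    rw [← normalize_normalized_factor P hP]
    exact monic_normalize (hirr P hP).ne_zero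
  have hdeg : ∑ P ∈ nf.toFinset, nf.count P * P.natDegree = n := by
    have h1 : nf.prod = g := by rw [hnf, prod_normalizedFactors_eq hg0, hg.normalize_eq_self]
    have h2 := natDegree_multiset_prod_of_monic nf hmon
    rw [h1, Finset.sum_multiset_map_count] at h2
    rw [hn, h2]; rfl
  have hpow : ∀ P : F[X], P.Monic → Irreducible P → ∀ k, P ^ k ∣ g ↔ k ≤ nf.count P := by
    intro P hPm hPi k
    rw [pow_dvd_iff_le_emultiplicity, emultiplicity_eq_count_normalizedFactors hPi hg0,
      hPm.normalize_eq_self]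
    exact_mod_cast Iff.rfl
  conv_rhs => rw [← hdeg]
  have h1 : ∀ i ∈ range (n + 1), ∑ P ∈ irrPoly F i,
      (if P ^ (i / P.natDegree) ∣ g then P.natDegree else 0) =
      ∑ P ∈ nf.toFinset, (if P ∈ irrPoly F i ∧ P ^ (i / P.natDegree) ∣ g
        then P.natDegree else 0) := by
    intro i _
    rw [← Finset.sum_filter, ← Finset.sum_filter]
    apply Finset.sum_congr _ (fun _ _ => rfl)
    ext P
    rw [mem_filter, mem_filter]
    constructor
    · rintro ⟨hP, hd⟩
      refine ⟨?_, hP, hd⟩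
      rw [mem_irrPoly] at hP
      have hpos := hP.2.1.natDegree_pos
      have hk : 1 ≤ i / P.natDegree := Nat.div_pos hP.2.2.2 hpos
      rw [hpow P hP.1 hP.2.1] at hd
      rw [Multiset.mem_toFinset]
      exact Multiset.count_pos.1 (by omega)
    · rintro ⟨-, hP, hd⟩
      exact ⟨hP, hd⟩
  rw [Finset.sum_congr rfl h1, Finset.sum_comm]
  apply Finset.sum_congr rfl
  intro P hP
  have hPn : P ∈ nf := Multiset.mem_toFinset.1 hP
  have hPm := hmon P hPn
  have hPi := hirr P hPn
  have hpos := hPi.natDegree_pos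
  rw [← Finset.sum_filter, Finset.sum_const, smul_eq_mul]
  congr 1
  have h2 : nf.count P = #(Icc 1 (nf.count P)) := by simp
  rw [h2]
  symm
  apply Finset.card_bij (fun k _ => k * P.natDegree)
  · intro k hk
    rw [mem_Icc] at hk
    have hdiv : k * P.natDegree / P.natDegree = k := Nat.mul_div_cancel _ hpos
    have hd : P ^ k ∣ g := (hpow P hPm hPi k).2 hk.2
    rw [mem_filter, mem_irrPoly, hdiv, mem_range]
    refine ⟨?_, ⟨hPm, hPi, dvd_mul_left _ _, Nat.le_mul_of_pos_left _ hk.1⟩, hd⟩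
    have := natDegree_le_of_dvd hd hg0
    rw [natDegree_pow] at this
    omega
  · intro a _ b _ hab
    exact Nat.eq_of_mul_eq_mul_right hpos hab
  · intro i hi
    rw [mem_filter, mem_irrPoly] at hi
    obtain ⟨k, rfl⟩ := hi.2.1.2.2.1
    refine ⟨k, ?_, mul_comm _ _⟩
    have h3 := hi.2.2
    rw [Nat.mul_div_cancel_left _ hpos, hpow P hPm hPi] at h3
    rw [mem_Icc]
    refine ⟨?_, h3⟩
    have h4 := hi.2.1.2.2.2
    rcases Nat.eq_zero_or_pos k with h | h
    · subst h; omega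
    · exact h

lemma euler_identity (ψ : F[X] →* ℂ) (n : ℕ) :
    (n : ℂ) * ∑ g ∈ monPoly F n, ψ g =
      ∑ x ∈ HasAntidiagonal.antidiagonal n,
        (∑ P ∈ irrPoly F x.1, (P.natDegree : ℂ) * ψ P ^ (x.1 / P.natDegree)) *
          ∑ h ∈ monPoly F x.2, ψ h := by
  classical
  have h1 : (n : ℂ) * ∑ g ∈ monPoly F n, ψ g = ∑ g ∈ monPoly F n, 
      ∑ i ∈ range (n + 1), ∑ P ∈ irrPoly F i,
      (if P ^ (i / P.natDegree) ∣ g then (P.natDegree : ℂ) * ψ g else 0) := by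
    rw [Finset.mul_sum]
    apply Finset.sum_congr rfl
    intro g hg
    rw [mem_monPoly] at hg
    have := degree_identity g hg.1
    rw [hg.2] at this
    conv_lhs => rw [← this]
    push_cast
    rw [Finset.sum_mul]
    apply Finset.sum_congr rfl
    intro i _
    rw [Finset.sum_mul]
    apply Finset.sum_congr rfl
    intro P _
    split_ifs <;> simp
  rw [h1, Finset.sum_comm, Finset.Nat.sum_antidiagonal_eq_sum_range_succ_mk]
  apply Finset.sum_congr rfl
  intro i hi
  rw [mem_range] at hi
  rw [Finset.sum_comm, Finset.sum_mul]
  apply Finset.sum_congr rfl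
  intro P hP
  rw [mem_irrPoly] at hP
  have hpos := hP.2.1.natDegree_pos
  obtain ⟨hPm, hPi, ⟨k, rfl⟩, hle⟩ := hP
  rw [Nat.mul_div_cancel_left _ hpos]
  rw [← Finset.sum_filter, ← Finset.mul_sum, mul_assoc]
  congr 1
  rw [Finset.mul_sum]
  symm
  have hPk : (P ^ k).Monic := hPm.pow k
  apply Finset.sum_bij (fun h _ => P ^ k * h)
  · intro h hh
    rw [mem_monPoly] at hh
    rw [mem_filter, mem_monPoly]
    refine ⟨⟨hPk.mul hh.1, ?_⟩, dvd_mul_right _ _⟩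
    rw [hPk.natDegree_mul hh.1, hPm.natDegree_pow, hh.2, mul_comm k]
    simp only
    omega
  · intro a _ b _ hab
    exact mul_left_cancel₀ hPk.ne_zero hab
  · intro g hg
    rw [mem_filter, mem_monPoly] at hg
    obtain ⟨⟨hgm, hgd⟩, ⟨h, rfl⟩⟩ := hg
    have hhm : h.Monic := hPk.of_mul_monic_left hgm
    refine ⟨h, ?_, rfl⟩
    rw [mem_monPoly]
    refine ⟨hhm, ?_⟩
    rw [hPk.natDegree_mul hhm, hPm.natDegree_pow, mul_comm k] at hgd
    simp only
    omega
  · intro h _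
    rw [map_mul, map_pow]

end Euler

section Ext
open Polynomial
variable {F K : Type*} [Field F] [Fintype F] [Field K] [Fintype K] [Algebra F K]

lemma norm_sub_eq (x : K) (α : F) :
    Algebra.norm F (algebraMap F K α - x) =
      (minpoly F x).eval α ^ (Module.finrank F K / (minpoly F x).natDegree) := by
  set r := (minpoly F x).natDegree with hr
  set n := Module.finrank F K with hn
  set y := x - algebraMap F K α with hy
  have hint : IsIntegral F y := Algebra.IsIntegral.isIntegral y
  have hmin : minpoly F y = (minpoly F x).comp (X + C α) := minpoly.sub_algebraMap x α
  have hdeg : (minpoly F y).natDegree = r := by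
    rw [hmin, natDegree_comp, natDegree_X_add_C, mul_one]
  have hc0 : (minpoly F y).coeff 0 = (minpoly F x).eval α := by
    rw [hmin, coeff_zero_eq_eval_zero, eval_comp]; simp
  have hrank : r * Module.finrank (IntermediateField.adjoin F {y}) K = n := by
    rw [← hdeg, ← IntermediateField.adjoin.finrank hint]
    exact Module.finrank_mul_finrank ..
  have hrpos : 0 < r := minpoly.natDegree_pos (Algebra.IsIntegral.isIntegral x)
  have hk : n / r = Module.finrank (IntermediateField.adjoin F {y}) K := by
    rw [← hrank, Nat.mul_div_cancel_left _ hrpos]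
  have hnorm : Algebra.norm F y = ((-1) ^ r * (minpoly F x).eval α) ^ (n / r) := by
    rw [Algebra.norm_eq_norm_adjoin, ← hk]
    congr 1
    have := Algebra.PowerBasis.norm_gen_eq_coeff_zero_minpoly
      (IntermediateField.adjoin.powerBasis hint)
    rw [IntermediateField.adjoin.powerBasis_gen, IntermediateField.minpoly_gen, hc0,
      IntermediateField.adjoin.powerBasis_dim, hdeg] at this
    exact this
  have hneg : algebraMap F K α - x = algebraMap F K (-1) * y := by
    rw [hy, map_neg, map_one]; ring
  rw [hneg, map_mul, hnorm, Algebra.norm_algebraMap, ← hn, mul_pow, ← pow_mul, ← mul_assoc,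
    ← pow_add]
  have : n + r * (n / r) = 2 * n := by rw [hk, hrank]; ring
  rw [this, pow_mul]; simp

lemma sum_ext_eq (n : ℕ) (hn : 1 ≤ n) (hK : Module.finrank F K = n) (φ : F[X] → ℂ) :
    ∑ x : K, φ (minpoly F x) = ∑ P ∈ irrPoly F n, (P.natDegree : ℂ) * φ P := by
  classical
  have hint : ∀ x : K, IsIntegral F x := fun x => Algebra.IsIntegral.isIntegral x
  have hmaps : ∀ x ∈ (univ : Finset K), minpoly F x ∈ irrPoly F n := by
    intro x _
    have hd : (minpoly F x).natDegree ∣ n := by rw [← hK]; exact minpoly.degree_dvd (hint x)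
    rw [mem_irrPoly]
    exact ⟨minpoly.monic (hint x), minpoly.irreducible (hint x), hd, Nat.le_of_dvd hn hd⟩
  rw [← Finset.sum_fiberwise_of_maps_to hmaps]
  apply Finset.sum_congr rfl
  intro P hP
  rw [mem_irrPoly] at hP
  obtain ⟨hPm, hPi, hd, -⟩ := hP
  rw [Finset.sum_congr rfl (g := fun _ => φ P)]
  · rw [Finset.sum_const, nsmul_eq_mul]
    congr 2
    have hcardK : Fintype.card K = Nat.card F ^ n := by
      rw [← hK, ← Module.natCard_eq_pow_finrank, Nat.card_eq_fintype_card]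
    have hdvd := hPi.natDegree_dvd_iff_dvd_X_pow_card_pow_sub_X.1 hd
    have hsplit : (P.map (algebraMap F K)).Splits := by
      have h1 := (FiniteField.isSplittingField_sub K F).splits
      rw [hcardK] at h1
      refine h1.of_dvd ?_ (map_dvd (algebraMap F K) hdvd)
      apply Polynomial.map_ne_zero
      rw [← hcardK]
      exact FiniteField.X_pow_card_sub_X_ne_zero F Fintype.one_lt_card
    have hsep : P.Separable := PerfectField.separable_of_irreducible hPi
    rw [← card_rootSet_eq_natDegree hsep hsplit, ← Set.toFinset_card]
    congr 1
    ext x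
    rw [mem_filter, Set.mem_toFinset, mem_rootSet]
    constructor
    · rintro ⟨-, rfl⟩
      exact ⟨minpoly.ne_zero (hint x), minpoly.aeval F x⟩
    · rintro ⟨-, h⟩
      exact ⟨mem_univ _, (minpoly.eq_of_irreducible_of_monic hPi h hPm).symm⟩
  · intro x hx
    rw [(mem_filter.1 hx).2]

end Ext

open Finset

section Weil
open Polynomial

/-- The multiplicative function on polynomials attached to a character. -/
noncomputable def psiHom {F : Type*} [Field F] {ι : Type*} [Fintype ι] (χ : MulChar F ℂ)
    (α : ι → F) (e : ι → ℕ) : F[X] →* ℂ where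
  toFun g := χ (∏ i, (g.eval (α i)) ^ e i)
  map_one' := by simp
  map_mul' g h := by
    rw [← map_mul, ← Finset.prod_mul_distrib]
    simp [mul_pow]

lemma psiHom_apply {F : Type*} [Field F] {ι : Type*} [Fintype ι] (χ : MulChar F ℂ)
    (α : ι → F) (e : ι → ℕ) (g : F[X]) : psiHom χ α e g = χ (∏ i, (g.eval (α i)) ^ e i) := rfl

lemma psi_sum_eq_zero {F : Type*} [Field F] [Fintype F] {ι : Type*} [Fintype ι] [DecidableEq ι]
    (χ : MulChar F ℂ) (hχ : χ ≠ 1) (α : ι → F) (e : ι → ℕ) (i₀ : ι)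
    (hα : ∀ i, i ≠ i₀ → α i ≠ α i₀) (he : e i₀ = 1) (k : ℕ) (hk : Fintype.card ι ≤ k) :
    ∑ g ∈ monPoly F k, psiHom χ α e g = 0 := by
  set h : F[X] := ∏ i ∈ univ.erase i₀, (X - C (α i)) with hh
  have hcard : 0 < Fintype.card ι := Fintype.card_pos_iff.2 ⟨i₀⟩
  have hdeg : h.natDegree < k := by
    rw [hh, natDegree_prod_of_monic _ _ (fun i _ => monic_X_sub_C _)]
    simp only [natDegree_X_sub_C, Finset.sum_const, smul_eq_mul, mul_one]
    rw [card_erase_of_mem (mem_univ _), card_univ]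
    omega
  have hev0 : h.eval (α i₀) ≠ 0 := by
    rw [hh, eval_prod, Finset.prod_ne_zero_iff]
    intro i hi
    rw [eval_sub, eval_X, eval_C]
    exact sub_ne_zero.2 (hα i (mem_erase.1 hi).1).symm
  have hev : ∀ i, i ≠ i₀ → h.eval (α i) = 0 := by
    intro i hi
    rw [hh, eval_prod]
    exact Finset.prod_eq_zero (mem_erase.2 ⟨hi, mem_univ _⟩) (by simp)
  have hmem : ∀ (t : F) (g : F[X]), g ∈ monPoly F k → g + C t * h ∈ monPoly F k := by
    intro t g hg
    rw [mem_monPoly] at hg ⊢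
    have hlt : (C t * h).degree < g.degree := by
      rw [degree_eq_natDegree hg.1.ne_zero, hg.2]
      refine lt_of_le_of_lt degree_le_natDegree ?_
      exact_mod_cast lt_of_le_of_lt (natDegree_C_mul_le _ _) hdeg
    exact ⟨hg.1.add_of_left hlt, by rw [natDegree_add_eq_left_of_degree_lt hlt, hg.2]⟩
  have hshift : ∀ t : F, ∑ g ∈ monPoly F k, psiHom χ α e (g + C t * h) =
      ∑ g ∈ monPoly F k, psiHom χ α e g := by
    intro t
    refine Finset.sum_bij' (fun g _ => g + C t * h) (fun g _ => g + C (-t) * h)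
      (fun g hg => hmem t g hg) (fun g hg => hmem (-t) g hg) ?_ ?_ ?_
    · intro g _; simp
    · intro g _; simp
    · intro g _; rfl
  have hinner : ∀ g : F[X], ∑ t : F, psiHom χ α e (g + C t * h) = 0 := by
    intro g
    have h1 : ∀ t : F, psiHom χ α e (g + C t * h) =
        χ (∏ i ∈ univ.erase i₀, (g.eval (α i)) ^ e i) *
          χ (g.eval (α i₀) + t * h.eval (α i₀)) := by
      intro t
      rw [psiHom_apply, ← Finset.prod_erase_mul univ _ (mem_univ i₀), map_mul, he, pow_one]
      congr 2
      · apply Finset.prod_congr rfl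
        intro i hi
        rw [eval_add, eval_mul, hev i (mem_erase.1 hi).1, mul_zero, add_zero]
      · simp
    simp only [h1]
    rw [← Finset.mul_sum]
    have h2 : ∑ t : F, χ (g.eval (α i₀) + t * h.eval (α i₀)) = ∑ t : F, χ t := by
      apply Fintype.sum_bijective (fun t => g.eval (α i₀) + t * h.eval (α i₀))
      · exact ((Equiv.mulRight₀ _ hev0).trans (Equiv.addLeft (g.eval (α i₀)))).bijective
      · intro t; rfl
    rw [h2, MulChar.sum_eq_zero_of_ne_one hχ, mul_zero]
  have h3 : ∑ t : F, ∑ g ∈ monPoly F k, psiHom χ α e (g + C t * h) = 0 := by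
    rw [Finset.sum_comm]
    exact Finset.sum_eq_zero fun g _ => hinner g
  simp only [hshift, Finset.sum_const, card_univ, nsmul_eq_mul] at h3
  rcases mul_eq_zero.1 h3 with h4 | h4
  · exact absurd (Nat.cast_eq_zero.1 h4) Fintype.card_ne_zero
  · exact h4

theorem weil_bound {F : Type} [Field F] [Fintype F] [DecidableEq F] {ι : Type*} [Fintype ι]
    [DecidableEq ι]
    (χ : MulChar F ℂ) (hχ : χ ≠ 1) (α : ι → F) (e : ι → ℕ) (i₀ : ι)
    (hα : ∀ i, i ≠ i₀ → α i ≠ α i₀) (he : e i₀ = 1) :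
    ‖∑ x : F, χ (∏ i, (α i - x) ^ e i)‖ ≤ Fintype.card ι * √(Fintype.card F) := by
  set q := Fintype.card F with hq
  have hqpos : 0 < q := Fintype.card_pos
  set ψ := psiHom χ α e with hψ
  set m := ∑ i, e i with hm
  have hc1 : ∑ g ∈ monPoly F 1, ψ g = ∑ x : F, χ (∏ i, (α i - x) ^ e i) := by
    symm
    apply Finset.sum_bij (fun (x : F) _ => (X - C x : F[X]))
    · intro x _; rw [mem_monPoly]; exact ⟨monic_X_sub_C x, natDegree_X_sub_C x⟩
    · intro a _ b _ hab
      exact C_injective (sub_right_injective hab)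
    · intro g hg
      rw [mem_monPoly] at hg
      refine ⟨-g.coeff 0, mem_univ _, ?_⟩
      have := hg.1.eq_X_add_C hg.2
      conv_rhs => rw [this]
      simp
    · intro x _
      rw [hψ, psiHom_apply]; simp
  rw [← hc1]
  apply coeff_bound (fun n => ∑ g ∈ monPoly F n, ψ g)
    (fun n => ∑ P ∈ irrPoly F n, (P.natDegree : ℂ) * ψ P ^ (n / P.natDegree)) (Fintype.card ι)
    ((q * (4 * m + 5) + m : ℕ) : ℝ) (√q) (by positivity)
  · have : monPoly F 0 = {1} := by
      ext g
      rw [mem_monPoly, mem_singleton]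
      constructor
      · rintro ⟨h1, h2⟩; exact h1.natDegree_eq_zero.1 h2
      · rintro rfl; simp
    simp [this]
  · intro k hk
    exact psi_sum_eq_zero χ hχ α e i₀ hα he k hk.le
  · apply Finset.sum_eq_zero
    intro P hP
    rw [mem_irrPoly] at hP
    have := hP.2.1.natDegree_pos
    omega
  · intro n
    exact euler_identity ψ n
  · intro n hn
    obtain ⟨p, hp⟩ := CharP.exists F
    have hpp : Fact p.Prime := ⟨CharP.char_is_prime F p⟩
    have hne : NeZero (2 * n) := ⟨by omega⟩
    let K := FiniteField.Extension F p (2 * n)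
    let _ : Fintype K := Fintype.ofFinite K
    have hfin : Module.finrank F K = 2 * n := FiniteField.finrank_extension F p (2 * n)
    have hcardK : Fintype.card K = q ^ (2 * n) := by
      have := FiniteField.natCard_extension F p (2 * n)
      rwa [Nat.card_eq_fintype_card, Nat.card_eq_fintype_card] at this
    have h1 := sum_ext_eq (F := F) (K := K) (2 * n) (by omega) hfin
      (fun P => ψ P ^ (2 * n / P.natDegree))
    rw [← h1]
    set αK : ι → K := fun i => algebraMap F K (α i) with hαK
    set g : K[X] := - ∏ i ∈ univ.erase i₀, (C (αK i) - X) ^ e i with hg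
    have hfg : (X - C (αK i₀)) * g = ∏ i, (C (αK i) - X) ^ e i := by
      rw [hg, ← Finset.mul_prod_erase univ _ (mem_univ i₀), he]; ring
    have h2 : ∀ x : K, ψ (minpoly F x) ^ (2 * n / (minpoly F x).natDegree) =
        χ (Algebra.norm F (((X - C (αK i₀)) * g).eval x)) := by
      intro x
      rw [hψ, psiHom_apply, ← map_pow, hfg, eval_prod, map_prod, ← Finset.prod_pow]
      congr 1
      apply Finset.prod_congr rfl
      intro i _
      rw [eval_pow, map_pow, eval_sub, eval_C, eval_X, norm_sub_eq, hfin, ← pow_mul, ← pow_mul,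
        mul_comm (e i)]
    rw [Finset.sum_congr rfl fun x _ => h2 x]
    have hgev : g.eval (αK i₀) ≠ 0 := by
      rw [hg, eval_neg, neg_ne_zero, eval_prod, Finset.prod_ne_zero_iff]
      intro i hi
      rw [eval_pow, eval_sub, eval_C, eval_X]
      apply pow_ne_zero
      rw [sub_ne_zero]
      intro h
      exact hα i (mem_erase.1 hi).1 ((algebraMap F K).injective h)
    have hdeg : ((X - C (αK i₀)) * g).natDegree ≤ m := by
      rw [hfg]
      refine (natDegree_prod_le _ _).trans ?_
      apply Finset.sum_le_sum
      intro i _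
      refine natDegree_pow_le.trans ?_
      have : (C (αK i) - X : K[X]).natDegree ≤ 1 := by
        refine (natDegree_sub_le _ _).trans ?_
        simp
      calc e i * _ ≤ e i * 1 := Nat.mul_le_mul_left _ this
        _ = e i := mul_one _
    have h3 := norm_sum_bound χ hχ n m hn hcardK (αK i₀) g hgev hdeg
    refine h3.trans (le_of_eq ?_)
    rw [pow_mul, Real.sq_sqrt (Nat.cast_nonneg _)]

end Weil

theorem bad_card {F : Type} [DecidableEq F] (A : Finset F) (k : ℕ) (hk : 1 ≤ k) :
    #{w ∈ Fintype.piFinset (fun _ : Fin k ⊕ Fin k => A) | ∀ i, ∃ j, j ≠ i ∧ w j = w i} ≤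
      #A ^ k * k ^ (2 * k) := by
  classical
  have hcard : #((Fintype.piFinset (fun _ : Fin k => A)) ×ˢ
      (univ : Finset (Fin k ⊕ Fin k → Fin k))) = #A ^ k * k ^ (2 * k) := by
    rw [card_product, Fintype.card_piFinset, card_univ, Fintype.card_fun]
    simp [two_mul]
  rw [← hcard]
  refine le_trans (card_le_card ?_) (card_image_le (f := fun p : (Fin k → F) × (Fin k ⊕ Fin k → Fin k) => p.1 ∘ p.2))
  intro w hw
  rw [mem_filter, Fintype.mem_piFinset] at hw
  obtain ⟨hwA, hbad⟩ := hw
  have h2 : #(univ.image w) ≤ k := by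
    have h : ∀ a ∈ univ.image w, 2 ≤ #{i ∈ (univ : Finset (Fin k ⊕ Fin k)) | w i = a} := by
      intro a ha
      obtain ⟨i, _, rfl⟩ := mem_image.1 ha
      obtain ⟨j, hj, hji⟩ := hbad i
      exact one_lt_card.2 ⟨j, by simp [hji], i, by simp, hj⟩
    have := mul_card_image_le_card univ 2 h
    rw [card_univ, Fintype.card_sum, Fintype.card_fin] at this
    omega
  have hne : Nonempty (Fin k ⊕ Fin k) := ⟨Sum.inl ⟨0, hk⟩⟩
  obtain ⟨τ⟩ : Nonempty ((univ.image w : Finset F) ↪ Fin k) :=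
    Function.Embedding.nonempty_of_card_le (by simpa using h2)
  have hmem : ∀ i, w i ∈ univ.image w := fun i => mem_image_of_mem _ (mem_univ i)
  have hne' : Nonempty (univ.image w : Finset F) := ⟨⟨_, hmem hne.some⟩⟩
  rw [mem_image]
  refine ⟨(fun j => ((Function.invFun τ j : (univ.image w : Finset F)) : F),
    fun i => τ ⟨w i, hmem i⟩), ?_, ?_⟩
  · rw [mem_product, Fintype.mem_piFinset]
    refine ⟨fun j => ?_, mem_univ _⟩
    obtain ⟨i, _, hi⟩ := mem_image.1 (Function.invFun τ j).2
    simp only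
    rw [← hi]
    exact hwA i
  · funext i
    simp [Function.leftInverse_invFun τ.injective _]

theorem three_le_card {F : Type} [Field F] [Fintype F] [DecidableEq F] (χ : MulChar F ℂ) (hχ : χ ≠ 1) : 3 ≤ Fintype.card F := by
  by_contra h
  apply hχ
  have h2 : Fintype.card F = 2 := by
    have := Fintype.one_lt_card (α := F)
    omega
  have hu : Fintype.card Fˣ = 1 := by rw [Fintype.card_units, h2]
  ext u
  have : u = 1 := by
    have := Fintype.card_le_one_iff.1 hu.le u 1
    exact this
  rw [this]; simp

theorem inv_char_pow {F : Type} [Field F] [Fintype F] [DecidableEq F] (χ : MulChar F ℂ)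
    (hq : 3 ≤ Fintype.card F) (a : F) : χ⁻¹ a = χ (a ^ (Fintype.card F - 2)) := by
  rw [MulChar.inv_apply']
  by_cases ha : a = 0
  · rw [ha, zero_pow (by omega), inv_zero]
  · congr 1
    symm
    rw [← mul_eq_one_iff_eq_inv₀ ha, ← pow_succ]
    rw [← FiniteField.pow_card_sub_one_eq_one a ha]
    congr 1; omega

/-- the pair of characters -/
noncomputable def pairChar {F : Type} [Field F] (χ : MulChar F ℂ) (k : ℕ) :
    Fin k ⊕ Fin k → MulChar F ℂ := Sum.elim (fun _ => χ) (fun _ => χ⁻¹)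

theorem good_bound {F : Type} [Field F] [Fintype F] [DecidableEq F] (χ : MulChar F ℂ)
    (hχ : χ ≠ 1) (k : ℕ) (w : Fin k ⊕ Fin k → F) (i₀ : Fin k ⊕ Fin k)
    (hw : ∀ i, i ≠ i₀ → w i ≠ w i₀) :
    ‖∑ x : F, ∏ i, pairChar χ k i (w i - x)‖ ≤ 2 * k * √(Fintype.card F) := by
  have hq := three_le_card χ hχ
  have key : ∀ (θ : MulChar F ℂ), θ ≠ 1 → ∀ e : Fin k ⊕ Fin k → ℕ, e i₀ = 1 →
      (∀ i a, pairChar χ k i a = θ (a ^ e i)) →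
      ‖∑ x : F, ∏ i, pairChar χ k i (w i - x)‖ ≤ 2 * k * √(Fintype.card F) := by
    intro θ hθ e he h
    have := weil_bound θ hθ w e i₀ hw he
    simp only [map_prod] at this
    simp only [h]
    refine this.trans (le_of_eq ?_)
    rw [Fintype.card_sum, Fintype.card_fin]
    push_cast; ring
  rcases i₀ with j | j
  · refine key χ hχ (Sum.elim (fun _ => 1) (fun _ => Fintype.card F - 2)) rfl ?_
    rintro (i | i) a
    · simp [pairChar]
    · simp only [pairChar, Sum.elim_inr]
      exact inv_char_pow χ hq a
  · refine key χ⁻¹ (inv_ne_one.2 hχ) (Sum.elim (fun _ => Fintype.card F - 2) (fun _ => 1)) rfl ?_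
    rintro (i | i) a
    · simp only [pairChar, Sum.elim_inl]
      rw [← inv_char_pow χ⁻¹ hq a, inv_inv]
    · simp [pairChar]

theorem conj_char {F : Type} [Field F] [Fintype F] (χ : MulChar F ℂ) (a : F) :
    (starRingEnd ℂ) (χ a) = χ⁻¹ a := by
  exact MulChar.star_apply' χ a

theorem moment_bound {F : Type} [Field F] [Fintype F] [DecidableEq F] (χ : MulChar F ℂ)
    (hχ : χ ≠ 1) (A : Finset F) (k : ℕ) (hk : 1 ≤ k) :
    ∑ x : F, ‖∑ a ∈ A, χ (a - x)‖ ^ (2 * k) ≤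
      (#A : ℝ) ^ k * k ^ (2 * k) * Fintype.card F +
      (#A : ℝ) ^ (2 * k) * (2 * k * √(Fintype.card F)) := by
  have h1 : ∀ x : F, (((‖∑ a ∈ A, χ (a - x)‖ ^ (2 * k) : ℝ)) : ℂ) =
      ∑ w ∈ Fintype.piFinset (fun _ : Fin k ⊕ Fin k => A), ∏ i, pairChar χ k i (w i - x) := by
    intro x
    have := Finset.prod_univ_sum (fun _ : Fin k ⊕ Fin k => A)
      (fun i a => pairChar χ k i (a - x))
    rw [← this, Fintype.prod_sum_type]
    simp only [pairChar, Sum.elim_inl, Sum.elim_inr, prod_const, card_univ, Fintype.card_fin]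
    rw [← mul_pow, pow_mul]
    push_cast
    congr 1
    rw [← Complex.mul_conj', map_sum]
    simp only [conj_char]
  have h2 : ((∑ x : F, ‖∑ a ∈ A, χ (a - x)‖ ^ (2 * k) : ℝ) : ℂ) =
      ∑ w ∈ Fintype.piFinset (fun _ : Fin k ⊕ Fin k => A),
        ∑ x : F, ∏ i, pairChar χ k i (w i - x) := by
    rw [Complex.ofReal_sum, Finset.sum_congr rfl fun x _ => h1 x, Finset.sum_comm]
  have h3 : (∑ x : F, ‖∑ a ∈ A, χ (a - x)‖ ^ (2 * k) : ℝ) =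
      ‖∑ w ∈ Fintype.piFinset (fun _ : Fin k ⊕ Fin k => A),
        ∑ x : F, ∏ i, pairChar χ k i (w i - x)‖ := by
    rw [← h2, Complex.norm_real, Real.norm_of_nonneg]
    exact Finset.sum_nonneg fun x _ => by positivity
  rw [h3]
  refine (norm_sum_le _ _).trans ?_
  rw [← Finset.sum_filter_add_sum_filter_not _
    (fun w : Fin k ⊕ Fin k → F => ∀ i, ∃ j, j ≠ i ∧ w j = w i)]
  apply add_le_add
  · have hb := bad_card A k hk
    refine (Finset.sum_le_card_nsmul _ _ (Fintype.card F : ℝ) ?_).trans ?_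
    · intro w _
      refine (norm_sum_le _ _).trans ?_
      refine (Finset.sum_le_card_nsmul _ _ (1 : ℝ) ?_).trans (by simp)
      intro x _
      rw [norm_prod]
      exact Finset.prod_le_one (fun _ _ => norm_nonneg _) fun i _ => mulChar_norm_le _ _
    · rw [nsmul_eq_mul]
      apply mul_le_mul_of_nonneg_right _ (Nat.cast_nonneg _)
      exact_mod_cast hb
  · refine (Finset.sum_le_card_nsmul _ _ (2 * k * √(Fintype.card F) : ℝ) ?_).trans ?_
    · intro w hw
      have := (mem_filter.1 hw).2
      push Not at this
      obtain ⟨i₀, h⟩ := this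
      exact good_bound χ hχ k w i₀ h
    · rw [nsmul_eq_mul]
      apply mul_le_mul_of_nonneg_right _ (by positivity)
      have : #{w ∈ Fintype.piFinset (fun _ : Fin k ⊕ Fin k => A) |
          ¬ ∀ i, ∃ j, j ≠ i ∧ w j = w i} ≤ #A ^ (2 * k) := by
        refine (card_filter_le _ _).trans ?_
        rw [Fintype.card_piFinset]
        simp [two_mul]
      exact_mod_cast this

noncomputable instance mulCharFintype {F : Type} [Field F] [Fintype F] :
    Fintype (MulChar F ℂ) := Fintype.ofFinite _

theorem sum_chars {F : Type} [Field F] [Fintype F] [DecidableEq F] (a : F) :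
    ∑ χ : MulChar F ℂ, χ a = if a = 1 then ((Fintype.card F - 1 : ℕ) : ℂ) else 0 := by
  split_ifs with ha
  · have := MulChar.card_eq_card_units_of_hasEnoughRootsOfUnity F ℂ
    rw [Nat.card_eq_fintype_card, Nat.card_eq_fintype_card, Fintype.card_units] at this
    simp only [ha, map_one, sum_const, card_univ, this, nsmul_eq_mul, mul_one]
  · obtain ⟨χ, hχ⟩ := MulChar.exists_apply_ne_one_of_hasEnoughRootsOfUnity F ℂ ha
    refine eq_zero_of_mul_eq_self_left hχ ?_
    simp only [Finset.mul_sum, ← MulChar.mul_apply]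
    exact Fintype.sum_bijective _ (Group.mulLeft_bijective χ) _ _ fun _ ↦ rfl

theorem parseval_chars {F : Type} [Field F] [Fintype F] [DecidableEq F] (B : Finset F)
    (hB : 0 ∉ B) :
    ∑ χ : MulChar F ℂ, ‖∑ b ∈ B, χ b‖ ^ 2 = ((Fintype.card F - 1 : ℕ) : ℝ) * #B := by
  have h : ((∑ χ : MulChar F ℂ, ‖∑ b ∈ B, χ b‖ ^ 2 : ℝ) : ℂ) =
      (((Fintype.card F - 1 : ℕ) : ℝ) * #B : ℝ) := by
    have h1 : ∀ χ : MulChar F ℂ, ((‖∑ b ∈ B, χ b‖ ^ 2 : ℝ) : ℂ) =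
        ∑ b ∈ B, ∑ c ∈ B, χ (b * c⁻¹) := by
      intro χ
      push_cast
      rw [← Complex.mul_conj', map_sum, Finset.sum_mul_sum]
      refine Finset.sum_congr rfl fun b _ => Finset.sum_congr rfl fun c _ => ?_
      rw [conj_char, MulChar.inv_apply', map_mul]
    rw [Complex.ofReal_sum, Finset.sum_congr rfl fun χ _ => h1 χ, Finset.sum_comm]
    have h2 : ∀ b ∈ B, ∑ χ : MulChar F ℂ, ∑ c ∈ B, χ (b * c⁻¹) =
        ((Fintype.card F - 1 : ℕ) : ℂ) := by
      intro b hb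
      rw [Finset.sum_comm]
      simp only [sum_chars]
      rw [Finset.sum_eq_single_of_mem b hb]
      · rw [if_pos]
        exact mul_inv_cancel₀ (fun h => hB (h ▸ hb))
      · intro c hc hcb
        rw [if_neg]
        intro h
        have hc0 : c ≠ 0 := fun h => hB (h ▸ hc)
        exact hcb ((mul_inv_eq_one₀ hc0).1 h).symm
    rw [Finset.sum_congr rfl h2]
    simp [mul_comm]
  exact_mod_cast h

set_option maxHeartbeats 1000000 in
theorem orth_bound {F : Type} [Field F] [Fintype F] [DecidableEq F] (E A B C : Finset F)
    (hB : 0 ∉ B) (hC : 0 ∉ C)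
    (hno : ∀ l ∈ E, ∀ a ∈ A, ∀ b ∈ B, ∀ c ∈ C, (a - l) * (b * c) ≠ 1) (M : ℝ) (hM0 : 0 ≤ M)
    (hM : ∀ χ : MulChar F ℂ, χ ≠ 1 → ‖∑ l ∈ E, ∑ a ∈ A, χ (a - l)‖ ≤ M) :
    (#A : ℝ) * (#E - 1) * √(#B * #C) ≤ M * Fintype.card F := by
  set S : MulChar F ℂ → ℂ := fun χ => ∑ l ∈ E, ∑ a ∈ A, χ (a - l) with hS
  set q := Fintype.card F with hq
  have hzero : ∑ χ : MulChar F ℂ, S χ * ((∑ b ∈ B, χ b) * (∑ c ∈ C, χ c)) = 0 := by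
    have h1 : ∀ χ : MulChar F ℂ, S χ * ((∑ b ∈ B, χ b) * (∑ c ∈ C, χ c)) =
        ∑ l ∈ E, ∑ a ∈ A, ∑ b ∈ B, ∑ c ∈ C, χ ((a - l) * (b * c)) := by
      intro χ
      simp only [hS, map_mul]
      rw [Finset.sum_mul_sum, Finset.sum_mul]
      refine Finset.sum_congr rfl fun l _ => ?_
      rw [Finset.sum_mul]
      refine Finset.sum_congr rfl fun a _ => ?_
      rw [Finset.mul_sum]
      refine Finset.sum_congr rfl fun b _ => ?_
      rw [Finset.mul_sum]
    rw [Finset.sum_congr rfl fun χ _ => h1 χ, Finset.sum_comm]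
    refine Finset.sum_eq_zero fun l hl => ?_
    rw [Finset.sum_comm]
    refine Finset.sum_eq_zero fun a ha => ?_
    rw [Finset.sum_comm]
    refine Finset.sum_eq_zero fun b hb => ?_
    rw [Finset.sum_comm]
    refine Finset.sum_eq_zero fun c hc => ?_
    rw [sum_chars, if_neg (hno l hl a ha b hb c hc)]
  have hone : ∀ D : Finset F, 0 ∉ D → ∑ b ∈ D, (1 : MulChar F ℂ) b = (#D : ℂ) := by
    intro D hD
    have h1 : ∀ b ∈ D, (1 : MulChar F ℂ) b = 1 := by
      intro b hb
      have hb0 : b ≠ 0 := by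
        rintro rfl
        exact hD hb
      exact MulChar.one_apply (isUnit_iff_ne_zero.2 hb0)
    rw [Finset.sum_congr rfl h1]
    simp
  have hS1 : (#A : ℝ) * (#E - 1) ≤ ‖S 1‖ := by
    have hval : S 1 = ((∑ a ∈ A, (#(E.erase a) : ℝ) : ℝ) : ℂ) := by
      rw [hS]
      simp only
      rw [Finset.sum_comm]
      push_cast
      refine Finset.sum_congr rfl fun a _ => ?_
      have h2 : ∀ l ∈ E, (1 : MulChar F ℂ) (a - l) = if l ∈ E.erase a then 1 else 0 := by
        intro l hl
        by_cases hla : l = a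
        · rw [hla, sub_self, MulChar.map_zero, if_neg (by simp)]
        · rw [if_pos (mem_erase.2 ⟨hla, hl⟩), MulChar.one_apply]
          exact isUnit_iff_ne_zero.2 (sub_ne_zero.2 (Ne.symm hla))
      rw [Finset.sum_congr rfl h2, Finset.sum_ite_mem, Finset.inter_eq_right.2 (erase_subset _ _)]
      simp
    rw [hval, Complex.norm_real, Real.norm_of_nonneg (Finset.sum_nonneg fun _ _ => Nat.cast_nonneg _)]
    rw [← nsmul_eq_mul]
    refine Finset.card_nsmul_le_sum _ _ _ fun a _ => ?_
    have := Finset.pred_card_le_card_erase (s := E) (a := a)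
    have h3 : #E ≤ #(E.erase a) + 1 := by omega
    have h4 : (#E : ℝ) ≤ #(E.erase a) + 1 := by exact_mod_cast h3
    linarith
  have hmain : ‖S 1‖ * (#B * #C) ≤ M * (q * √(#B * #C)) := by
    rw [← Finset.add_sum_erase univ _ (mem_univ (1 : MulChar F ℂ)), hone B hB, hone C hC,
      add_eq_zero_iff_eq_neg] at hzero
    have h5 := congrArg norm hzero
    rw [norm_mul, norm_mul, norm_neg, Complex.norm_natCast, Complex.norm_natCast] at h5
    rw [h5]
    refine (norm_sum_le _ _).trans ?_
    calc _ ≤ ∑ χ ∈ univ.erase (1 : MulChar F ℂ), M * (‖∑ b ∈ B, χ b‖ * ‖∑ c ∈ C, χ c‖) := by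
          refine Finset.sum_le_sum fun χ hχ => ?_
          rw [norm_mul, norm_mul]
          exact mul_le_mul_of_nonneg_right (hM χ (mem_erase.1 hχ).1) (by positivity)
      _ ≤ ∑ χ : MulChar F ℂ, M * (‖∑ b ∈ B, χ b‖ * ‖∑ c ∈ C, χ c‖) :=
          Finset.sum_le_sum_of_subset_of_nonneg (erase_subset _ _)
            fun _ _ _ => by positivity
      _ = M * ∑ χ : MulChar F ℂ, (‖∑ b ∈ B, χ b‖ * ‖∑ c ∈ C, χ c‖) := by rw [Finset.mul_sum]
      _ ≤ _ := by
          refine mul_le_mul_of_nonneg_left ?_ hM0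
          refine (Real.sum_mul_le_sqrt_mul_sqrt _ _ _).trans ?_
          rw [parseval_chars B hB, parseval_chars C hC, ← Real.sqrt_mul (by positivity)]
          have h6 : ((q - 1 : ℕ) : ℝ) ≤ q := by exact_mod_cast Nat.sub_le _ _
          rw [show ((q - 1 : ℕ) : ℝ) * #B * (((q - 1 : ℕ) : ℝ) * #C) =
            ((q - 1 : ℕ) : ℝ) ^ 2 * (#B * #C) by ring, Real.sqrt_mul (by positivity),
            Real.sqrt_sq (by positivity)]
          exact mul_le_mul_of_nonneg_right h6 (by positivity)
  rcases eq_or_lt_of_le (Real.sqrt_nonneg ((#B : ℝ) * #C)) with h0 | hpos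
  · rw [← h0, mul_zero]; positivity
  · have hsq := Real.mul_self_sqrt (by positivity : (0 : ℝ) ≤ (#B : ℝ) * #C)
    refine (mul_le_mul_of_nonneg_right hS1 hpos.le).trans ?_
    refine le_of_mul_le_mul_right ?_ hpos
    calc ‖S 1‖ * √(#B * #C) * √(#B * #C) = ‖S 1‖ * (#B * #C) := by rw [mul_assoc, hsq]
      _ ≤ _ := hmain
      _ = _ := by ring

theorem char_double_bound {F : Type} [Field F] [Fintype F] [DecidableEq F] (χ : MulChar F ℂ)
    (hχ : χ ≠ 1) (E A : Finset F) (k : ℕ) (hk : 1 ≤ k)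
    (hA : √(Fintype.card F) ≤ (#A : ℝ) ^ k) :
    ‖∑ l ∈ E, ∑ a ∈ A, χ (a - l)‖ ^ (2 * k) ≤
      (#E : ℝ) ^ (2 * k - 1) * ((#A : ℝ) ^ (2 * k) *
        √(Fintype.card F) * (k ^ (2 * k) + 2 * k)) := by
  have h1 := moment_bound χ hχ A k hk
  have h2 : ∑ x : F, ‖∑ a ∈ A, χ (a - x)‖ ^ (2 * k) ≤ (#A : ℝ) ^ (2 * k) *
        √(Fintype.card F) * (k ^ (2 * k) + 2 * k) := by
    refine h1.trans ?_
    have hs := Real.mul_self_sqrt (Nat.cast_nonneg (α := ℝ) (Fintype.card F))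
    have h3 : (#A : ℝ) ^ k * k ^ (2 * k) * Fintype.card F ≤
        (#A : ℝ) ^ (2 * k) * √(Fintype.card F) * k ^ (2 * k) := by
      calc (#A : ℝ) ^ k * k ^ (2 * k) * Fintype.card F
          = (#A : ℝ) ^ k * k ^ (2 * k) * √(Fintype.card F) * √(Fintype.card F) := by
            rw [mul_assoc _ (√_) (√_), hs]
        _ ≤ (#A : ℝ) ^ k * k ^ (2 * k) * √(Fintype.card F) * (#A : ℝ) ^ k := by gcongr
        _ = _ := by ring
    linarith
  have h4 : (∑ l ∈ E, ‖∑ a ∈ A, χ (a - l)‖) ^ (2 * k) ≤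
      (#E : ℝ) ^ (2 * k - 1) * ∑ l ∈ E, ‖∑ a ∈ A, χ (a - l)‖ ^ (2 * k) := by
    have := pow_sum_div_card_le_sum_pow (s := E) (f := fun l => ‖∑ a ∈ A, χ (a - l)‖)
      (fun _ _ => norm_nonneg _) (2 * k - 1)
    rw [show 2 * k - 1 + 1 = 2 * k by omega] at this
    rcases E.eq_empty_or_nonempty with rfl | hE
    · simp
      rw [zero_pow (by omega)]
    · have hc : (0 : ℝ) < #E := by exact_mod_cast hE.card_pos
      rw [div_le_iff₀ (by positivity)] at this
      exact this.trans (le_of_eq (mul_comm _ _))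
  calc _ ≤ (∑ l ∈ E, ‖∑ a ∈ A, χ (a - l)‖) ^ (2 * k) := by
        gcongr
        exact norm_sum_le _ _
    _ ≤ _ := h4
    _ ≤ (#E : ℝ) ^ (2 * k - 1) * ∑ l : F, ‖∑ a ∈ A, χ (a - l)‖ ^ (2 * k) := by
        gcongr
        exact Finset.subset_univ _
    _ ≤ _ := by gcongr

theorem card_erase_zero {F : Type} [Field F] [DecidableEq F] (G : Finset F)
    (h : (2 : ℝ) ≤ #G) : (#G : ℝ) / 2 ≤ #(G.erase 0) := by
  have := Finset.pred_card_le_card_erase (s := G) (a := (0 : F))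
  have h3 : #G ≤ #(G.erase 0) + 1 := by omega
  have h4 : (#G : ℝ) ≤ #(G.erase 0) + 1 := by exact_mod_cast h3
  linarith

/-- Corollary 2: for every `ε > 0` there exists `δ > 0` such that for all sufficiently
large finite fields `F` with `q` elements and all sets `F', G, H ⊆ F` with
`|F'| ≥ q^ε` and `|G||H| ≥ q^{2-δ}`, the set of `λ` for which `f + gh = λ` has no
solution has `O(q^{1/2+ε})` elements. -/
theorem exceptional_set_half (ε : ℝ) (hε : 0 < ε) :
    ∃ δ : ℝ, 0 < δ ∧ ∃ K : ℝ, 0 < K ∧ ∃ Q : ℕ,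
      ∀ (F : Type) [Field F] [Fintype F] [DecidableEq F],
        Q ≤ Fintype.card F →
        ∀ (F' G H : Finset F),
          (F'.card : ℝ) ≥ (Fintype.card F : ℝ) ^ (ε : ℝ) →
          (G.card * H.card : ℝ) ≥ (Fintype.card F : ℝ) ^ ((2 : ℝ) - δ) →
          ((Finset.univ.filter
              (fun lam : F => ∀ f ∈ F', ∀ g ∈ G, ∀ h ∈ H, f + g * h ≠ lam)).card : ℝ) ≤
            K * (Fintype.card F : ℝ) ^ ((1 : ℝ) / 2 + ε) := by
  obtain ⟨k0, hk0⟩ := exists_nat_ge (1 / (2 * ε))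
  set k := k0 + 1 with hkdef
  have hk : 1 ≤ k := by omega
  have hkR : (1 : ℝ) ≤ k := by exact_mod_cast hk
  have hkε : 1 / 2 ≤ ε * k := by
    have h1 : 1 / (2 * ε) ≤ (k : ℝ) := by
      rw [hkdef]; push_cast; linarith
    rw [div_le_iff₀ (by positivity)] at h1
    linarith
  set δ : ℝ := min (ε / k) (1 / 2) with hδ
  have hδ0 : 0 < δ := lt_min (by positivity) (by norm_num)
  have hδ1 : δ ≤ 1 / 2 := min_le_right _ _
  have hδk : δ * k ≤ ε := by
    have : δ ≤ ε / k := min_le_left _ _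
    rwa [le_div_iff₀ (by positivity)] at this
  set c : ℝ := (k : ℝ) ^ (2 * k) + 2 * k with hc
  have hc2 : 2 ≤ c := by
    have : (0 : ℝ) ≤ (k : ℝ) ^ (2 * k) := by positivity
    linarith
  refine ⟨δ, hδ0, 16 ^ k * c, by positivity, 4, ?_⟩
  intro F _ _ _ hQ A G H hA hGH
  set q : ℝ := (Fintype.card F : ℝ) with hq
  have hq4 : (4 : ℝ) ≤ q := by rw [hq]; exact_mod_cast hQ
  have hq0 : 0 < q := by linarith
  have hq1 : 1 ≤ q := by linarith
  set E := Finset.univ.filter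
    (fun lam : F => ∀ f ∈ A, ∀ g ∈ G, ∀ h ∈ H, f + g * h ≠ lam) with hE
  have hqe : 1 ≤ q ^ ((1 : ℝ) / 2 + ε) := Real.one_le_rpow hq1 (by positivity)
  have h16 : (1 : ℝ) ≤ 16 ^ k := one_le_pow₀ (by norm_num)
  rcases lt_or_ge (#E) 2 with hE2 | hE2
  · have h1 : (#E : ℝ) ≤ 2 := by exact_mod_cast hE2.le
    have h2 : (1 : ℝ) * 2 * 1 ≤ 16 ^ k * c * q ^ ((1 : ℝ) / 2 + ε) := by gcongr
    linarith
  have hE2R : (2 : ℝ) ≤ #E := by exact_mod_cast hE2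
  -- sizes of G and H
  have hsize : ∀ X Y : Finset F, q ^ ((2 : ℝ) - δ) ≤ #X * #Y → (2 : ℝ) ≤ #X := by
    intro X Y hXY
    have hY : (#Y : ℝ) ≤ q := by rw [hq]; exact_mod_cast Finset.card_le_univ Y
    have h1 : q ^ ((2 : ℝ) - δ) ≤ #X * q := hXY.trans (by gcongr)
    have h2 : q ^ ((1 : ℝ) / 2) * q ≤ q ^ ((2 : ℝ) - δ) := by
      rw [← Real.rpow_add_one hq0.ne']
      exact Real.rpow_le_rpow_of_exponent_le hq1 (by linarith)
    have h3 : q ^ ((1 : ℝ) / 2) ≤ #X := le_of_mul_le_mul_right (h2.trans h1) hq0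
    have h4 : (2 : ℝ) ≤ q ^ ((1 : ℝ) / 2) := by
      rw [← Real.sqrt_eq_rpow]
      exact Real.le_sqrt_of_sq_le (by linarith)
    linarith
  have hG2 := card_erase_zero G (hsize G H hGH)
  have hH2 := card_erase_zero H (hsize H G (by rw [mul_comm]; exact hGH))
  set B := (G.erase 0).image (fun g => -g⁻¹) with hB
  set C := (H.erase 0).image (fun h => h⁻¹) with hC
  have hBc : #B = #(G.erase 0) :=
    card_image_of_injective _ (fun a b h => inv_injective (neg_injective h))
  have hCc : #C = #(H.erase 0) := card_image_of_injective _ inv_injective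
  have hBC : q ^ ((2 : ℝ) - δ) / 4 ≤ (#B : ℝ) * #C := by
    rw [hBc, hCc]
    calc q ^ ((2 : ℝ) - δ) / 4 ≤ (#G * #H : ℝ) / 4 := by gcongr
      _ = (#G : ℝ) / 2 * (#H / 2) := by ring
      _ ≤ _ := by gcongr
  have hsq : q * q ^ (-δ / 2) / 2 ≤ √(#B * #C) := by
    refine le_trans (le_of_eq ?_) (Real.sqrt_le_sqrt hBC)
    symm
    rw [Real.sqrt_eq_iff_mul_self_eq (by positivity) (by positivity)]
    have : q ^ (-δ / 2) * q ^ (-δ / 2) = q ^ (-δ) := by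
      rw [← Real.rpow_add hq0]; congr 1; ring
    symm
    calc q * q ^ (-δ / 2) / 2 * (q * q ^ (-δ / 2) / 2)
        = q ^ 2 * (q ^ (-δ / 2) * q ^ (-δ / 2)) / 4 := by ring
      _ = _ := by
        rw [this, sub_eq_add_neg, Real.rpow_add hq0, Real.rpow_two]
  have hB0 : (0 : F) ∉ B := by
    rw [hB, mem_image]
    rintro ⟨g, hg, h⟩
    exact (mem_erase.1 hg).1 (by simpa using h)
  have hC0 : (0 : F) ∉ C := by
    rw [hC, mem_image]
    rintro ⟨g, hg, h⟩
    exact (mem_erase.1 hg).1 (by simpa using h)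
  have hno : ∀ l ∈ E, ∀ a ∈ A, ∀ b ∈ B, ∀ c ∈ C, (a - l) * (b * c) ≠ 1 := by
    intro l hl a ha b hb c hc h1
    obtain ⟨g, hg, rfl⟩ := mem_image.1 hb
    obtain ⟨h, hh, rfl⟩ := mem_image.1 hc
    obtain ⟨hg0, hg⟩ := mem_erase.1 hg
    obtain ⟨hh0, hh⟩ := mem_erase.1 hh
    refine (mem_filter.1 hl).2 a ha g hg h hh ?_
    field_simp at h1
    linear_combination -h1
  have hq12 : √q ≤ (#A : ℝ) ^ k := by
    calc √q = q ^ ((1 : ℝ) / 2) := Real.sqrt_eq_rpow q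
      _ ≤ q ^ (ε * k) := Real.rpow_le_rpow_of_exponent_le hq1 hkε
      _ = (q ^ ε) ^ k := by rw [Real.rpow_mul hq0.le, Real.rpow_natCast]
      _ ≤ _ := by gcongr
  have hA0 : (0 : ℝ) < #A := lt_of_lt_of_le (by positivity) hA
  set X : ℝ := (#E : ℝ) ^ (2 * k - 1) * ((#A : ℝ) ^ (2 * k) * √q * c) with hX
  have hX0 : 0 ≤ X := by positivity
  set M : ℝ := X ^ (((2 * k : ℕ) : ℝ)⁻¹) with hM
  have hMX : M ^ (2 * k) = X := Real.rpow_inv_natCast_pow hX0 (by omega)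
  have hM0 : 0 ≤ M := Real.rpow_nonneg hX0 _
  have horth := orth_bound E A B C hB0 hC0 hno M hM0 (by
    intro χ hχ
    have := char_double_bound χ hχ E A k hk hq12
    rw [← hq, ← hc, ← hX, ← hMX] at this
    exact le_of_pow_le_pow_left₀ (by omega) hM0 this)
  have h1 : (#A : ℝ) * #E * q ^ (-δ / 2) / 4 ≤ M := by
    refine le_of_mul_le_mul_right ?_ hq0
    refine le_trans ?_ horth
    calc (#A : ℝ) * #E * q ^ (-δ / 2) / 4 * q
        = (#A : ℝ) * (#E / 2) * (q * q ^ (-δ / 2) / 2) := by ring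
      _ ≤ _ := by
        gcongr
        · exact mul_nonneg hA0.le (by linarith)
        · linarith
  have h2 : ((#A : ℝ) * #E * q ^ (-δ / 2) / 4) ^ (2 * k) ≤ X := by
    rw [← hMX]; gcongr
  have h3 : (q ^ (-δ / 2)) ^ (2 * k) * q ^ (δ * k) = 1 := by
    rw [← Real.rpow_natCast, ← Real.rpow_mul hq0.le, ← Real.rpow_add hq0]
    convert Real.rpow_zero q using 2
    push_cast; ring
  have hEpos : (0 : ℝ) < #E := by linarith
  have h4 : (#E : ℝ) ≤ 16 ^ k * c * (q ^ (δ * k) * √q) := by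
    have hY : (0 : ℝ) < (#A : ℝ) ^ (2 * k) * (#E : ℝ) ^ (2 * k - 1) := by positivity
    refine le_of_mul_le_mul_left ?_ hY
    have he : (#E : ℝ) ^ (2 * k) = (#E : ℝ) ^ (2 * k - 1) * #E := by
      rw [← pow_succ]; congr 1
    have h44 : (4 : ℝ) ^ (2 * k) = 16 ^ k := by rw [pow_mul]; norm_num
    rw [div_pow, mul_pow, mul_pow, h44, he, div_le_iff₀ (by positivity)] at h2
    calc (#A : ℝ) ^ (2 * k) * (#E : ℝ) ^ (2 * k - 1) * #E
        = (#A : ℝ) ^ (2 * k) * ((#E : ℝ) ^ (2 * k - 1) * #E) * (q ^ (-δ / 2)) ^ (2 * k) *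
          q ^ (δ * k) := by
          rw [mul_assoc _ ((q ^ (-δ / 2)) ^ (2 * k)), h3]; ring
      _ ≤ X * 16 ^ k * q ^ (δ * k) := by gcongr
      _ = _ := by rw [hX]; ring
  refine h4.trans ?_
  have h5 : q ^ (δ * k) * √q ≤ q ^ ((1 : ℝ) / 2 + ε) := by
    rw [Real.sqrt_eq_rpow, ← Real.rpow_add hq0]
    exact Real.rpow_le_rpow_of_exponent_le hq1 (by linarith)
  gcongr
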